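/- Let Σ = ∂U be the closed C³ boundary of an open domain U ⊂ ℝⁿ, L = L(Σ), h the distance function to Σ, and σ(x) = x − 2h(x)∇h(x) the reflection across Σ. Then for every x in the sub-corona ω_{1/2} = { x ∈ U : 0 < d(x;Σ) < L/2 } with a = π(x), the second differential of σ satisfies |D²σ_x|_bil ≤ 16 max( 1/L , L |D²ν_a|_bil ), where D²ν_a is the second differential of the unit normal field ν at a. -/

import Mathlib

open MeasureTheory Metric Set Filter Topology
open scoped Pointwise ENNReal NNReal

noncomputable section

abbrev Euc (n : ℕ) := EuclideanSpace ℝ (Fin n)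

/-- Integral of a real function against a signed measure. -/
def sInt {α : Type*} [MeasurableSpace α] (μ : MeasureTheory.SignedMeasure α) (f : α → ℝ) : ℝ :=
  ∫ x, f x ∂μ.toJordanDecomposition.posPart - ∫ x, f x ∂μ.toJordanDecomposition.negPart

/-- A signed measure is concentrated on the set `S`. -/
def SuppOn {α : Type*} [MeasurableSpace α] (μ : MeasureTheory.SignedMeasure α) (S : Set α) : Prop :=
  ∀ t : Set α, MeasurableSet t → t ∩ S = ∅ → μ t = 0

/-- Total variation mass of a finite family of signed measures, seen as a vector measure,
via duality against continuous fields of pointwise Euclidean norm at most one. -/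
def vmass {α : Type*} [MeasurableSpace α] [TopologicalSpace α] {ι : Type*} [Fintype ι]
    (g : ι → MeasureTheory.SignedMeasure α) : ℝ :=
  sSup { r | ∃ Y : ι → α → ℝ, (∀ i, Continuous (Y i)) ∧ (∀ x, ∑ i, (Y i x) ^ 2 ≤ 1) ∧
      r = ∑ i, sInt (g i) (Y i) }

/-- `j`-th partial derivative. -/
def pd {n : ℕ} (j : Fin n) (ψ : Euc n → ℝ) (x : Euc n) : ℝ :=
  fderiv ℝ ψ x (EuclideanSpace.single j 1)

/-- Smooth test function compactly supported in `U`. -/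
def IsTestFun {n : ℕ} (U : Set (Euc n)) (ψ : Euc n → ℝ) : Prop :=
  ContDiff ℝ (⊤ : ℕ∞) ψ ∧ HasCompactSupport ψ ∧ tsupport ψ ⊆ U

/-- A `C¹` function with compact support (representing an element of `C¹(Ū)`). -/
def IsC1 {n : ℕ} (Y : Euc n → ℝ) : Prop := ContDiff ℝ 1 Y ∧ HasCompactSupport Y

/-- A symmetric Div-BV tensor on `U`: the entries and the row-wise distributional
divergence are finite (signed) Radon measures carried by `U`. -/
structure DivBV (n : ℕ) (U : Set (Euc n)) where
  A : Fin n → Fin n → MeasureTheory.SignedMeasure (Euc n)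
  divA : Fin n → MeasureTheory.SignedMeasure (Euc n)
  symm : ∀ i j, A i j = A j i
  suppA : ∀ i j, SuppOn (A i j) U
  suppDiv : ∀ i, SuppOn (divA i) U
  weak : ∀ i, ∀ ψ : Euc n → ℝ, IsTestFun U ψ →
    ∑ j, sInt (A i j) (pd j ψ) = - sInt (divA i) ψ

/-- Positive semi-definiteness of a matrix of measures. -/
def DivBV.PSD {n : ℕ} {U : Set (Euc n)} (T : DivBV n U) : Prop :=
  ∀ ξ : Fin n → ℝ, ∀ s : Set (Euc n), MeasurableSet s →
    0 ≤ ∑ i, ∑ j, ξ i * ξ j * (T.A i j) s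

/-- Density (Radon–Nikodym derivative w.r.t. Lebesgue) of a signed measure. -/
def sdens {n : ℕ} (μ : MeasureTheory.SignedMeasure (Euc n)) (x : Euc n) : ℝ :=
  (μ.toJordanDecomposition.posPart.rnDeriv volume x).toReal -
  (μ.toJordanDecomposition.negPart.rnDeriv volume x).toReal

/-- Pointwise determinant of the absolutely continuous part of a Div-BV tensor. -/
def DivBV.detDens {n : ℕ} {U : Set (Euc n)} (T : DivBV n U) (x : Euc n) : ℝ :=
  Matrix.det (Matrix.of fun i j => sdens (T.A i j) x)

/-- Total mass `‖A‖_{M(U)}` of the tensor. -/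
def DivBV.massA {n : ℕ} {U : Set (Euc n)} (T : DivBV n U) : ℝ :=
  vmass (fun p : Fin n × Fin n => T.A p.1 p.2)

/-- Total mass `‖Div A‖_{M(U)}` of the divergence. -/
def DivBV.massDiv {n : ℕ} {U : Set (Euc n)} (T : DivBV n U) : ℝ :=
  vmass T.divA

/-- The pairing `⟨A, ∇Y⟩_U + ⟨Div A, Y⟩_U` defining the normal trace `γ_ν A`. -/
def DivBV.tracePair {n : ℕ} {U : Set (Euc n)} (T : DivBV n U) (Y : Fin n → Euc n → ℝ) : ℝ :=
  (∑ i, ∑ j, sInt (T.A i j) (pd j (Y i))) + ∑ i, sInt (T.divA i) (Y i)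

/-- The normal trace `γ_ν A` is represented by the vector-valued measure `g` on `∂U`. -/
def DivBV.TraceMeas {n : ℕ} {U : Set (Euc n)} (T : DivBV n U)
    (g : Fin n → MeasureTheory.SignedMeasure (Euc n)) : Prop :=
  (∀ i, SuppOn (g i) (frontier U)) ∧
  ∀ Y : Fin n → Euc n → ℝ, (∀ i, IsC1 (Y i)) →
    T.tracePair Y = ∑ i, sInt (g i) (Y i)

/-- The tangential part `γ_ν^τ A` of the normal trace is represented by the
vector-valued measure `g` on `∂U` (with outer unit normal field `ν`): `g` is carried by `∂U`,
is tangential, and represents the trace pairing against all `C¹` fields tangential along `∂U`. -/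
def DivBV.TangTraceMeas {n : ℕ} {U : Set (Euc n)} (T : DivBV n U) (ν : Euc n → Euc n)
    (g : Fin n → MeasureTheory.SignedMeasure (Euc n)) : Prop :=
  (∀ i, SuppOn (g i) (frontier U)) ∧
  (∀ φ : Euc n → ℝ, Continuous φ → ∑ i, sInt (g i) (fun x => φ x * ν x i) = 0) ∧
  ∀ Y : Fin n → Euc n → ℝ, (∀ i, IsC1 (Y i)) →
    (∀ x ∈ frontier U, ∑ i, Y i x * ν x i = 0) →
    T.tracePair Y = ∑ i, sInt (g i) (Y i)

/-- A domain whose boundary is a `C^k` hypersurface, presented by a defining function. -/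
structure CkDomain (n k : ℕ) (U : Set (Euc n)) where
  f : Euc n → ℝ
  O : Set (Euc n)
  opO : IsOpen O
  front : frontier U ⊆ O
  smooth : ContDiffOn ℝ k f O
  grad_ne : ∀ x ∈ frontier U, gradient f x ≠ 0
  neg : ∀ x ∈ O ∩ U, f x < 0
  pos : ∀ x ∈ O \ closure U, 0 < f x
  zero : ∀ x ∈ frontier U, f x = 0

/-- The outer unit normal field (normalized gradient of the defining function). -/
def CkDomain.nu {n k : ℕ} {U : Set (Euc n)} (B : CkDomain n k U) (x : Euc n) : Euc n :=
  ‖gradient B.f x‖⁻¹ • gradient B.f x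

/-- `L(Σ)`: the largest `L` such that every point at distance `< L` of `Σ` has a unique
nearest point on `Σ`. -/
def uniqRadius {n : ℕ} (S : Set (Euc n)) : ℝ :=
  sSup { L : ℝ | 0 ≤ L ∧ ∀ x : Euc n, infDist x S < L →
    ∃! a, a ∈ S ∧ dist x a = infDist x S }

open Classical in
/-- Nearest-point projection on `S` (junk value if no nearest point exists). -/
def nearestPt {n : ℕ} (S : Set (Euc n)) (x : Euc n) : Euc n :=
  if h : ∃ a, a ∈ S ∧ dist x a = infDist x S then h.choose else x

/-- The geometric extension `ν ∘ π_Σ` of the unit normal to a tubular neighbourhood. -/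
def CkDomain.nuGeo {n k : ℕ} {U : Set (Euc n)} (B : CkDomain n k U) (x : Euc n) : Euc n :=
  B.nu (nearestPt (frontier U) x)

/-- `K(Σ) = max (1/L(Σ), L(Σ) ‖D²ν‖_∞)`. -/
def CkDomain.Kconst {n k : ℕ} {U : Set (Euc n)} (B : CkDomain n k U) : ℝ :=
  max (uniqRadius (frontier U))⁻¹
    (uniqRadius (frontier U) *
      sSup ((fun a => ‖fderiv ℝ (fderiv ℝ B.nuGeo) a‖) '' frontier U))

/-- The reflection `σ(x) = 2π_Σ(x) − x` across `Σ`. -/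
def reflAcross {n : ℕ} (S : Set (Euc n)) (x : Euc n) : Euc n :=
  (2 : ℝ) • nearestPt S x - x


section Metric

variable {n : ℕ} {S : Set (Euc n)}

lemma nearestPt_spec (hS : IsCompact S) (hne : S.Nonempty) (x : Euc n) :
    nearestPt S x ∈ S ∧ dist x (nearestPt S x) = infDist x S := by
  have h : ∃ a, a ∈ S ∧ dist x a = infDist x S := by
    obtain ⟨y, hy, h⟩ := hS.exists_infDist_eq_dist hne x
    exact ⟨y, hy, h.symm⟩
  unfold nearestPt
  rw [dif_pos h]
  exact h.choose_spec

lemma existsUnique_nearest_of_lt_uniqRadius {x : Euc n} (h : infDist x S < uniqRadius S) :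
    ∃! a, a ∈ S ∧ dist x a = infDist x S := by
  unfold uniqRadius at h
  have hne : { L : ℝ | 0 ≤ L ∧ ∀ x : Euc n, infDist x S < L →
      ∃! a, a ∈ S ∧ dist x a = infDist x S }.Nonempty :=
    ⟨0, le_rfl, fun x hx => absurd hx (not_lt.2 infDist_nonneg)⟩
  obtain ⟨r, hr, hlt⟩ := exists_lt_of_lt_csSup hne h
  exact hr.2 x hlt

lemma nearestPt_eq (hS : IsCompact S) {x b : Euc n} (h : infDist x S < uniqRadius S)
    (hb : b ∈ S) (hd : dist x b = infDist x S) : nearestPt S x = b :=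
  (existsUnique_nearest_of_lt_uniqRadius h).unique (nearestPt_spec hS ⟨b, hb⟩ x) ⟨hb, hd⟩

lemma nearestPt_continuousAt (hS : IsCompact S) (hne : S.Nonempty) {x : Euc n}
    (h : infDist x S < uniqRadius S) : ContinuousAt (nearestPt S) x := by
  rw [ContinuousAt, _root_.tendsto_nhds]
  intro V hV hxV
  rcases (S \ V).eq_empty_or_nonempty with he | hn
  · refine univ_mem' fun w => ?_
    by_contra hw
    exact he.subset (⟨(nearestPt_spec hS hne w).1, hw⟩ : nearestPt S w ∈ S \ V)
  have hc : IsCompact (S \ V) := hS.diff hV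
  have hlt : infDist x S < infDist x (S \ V) := by
    obtain ⟨y, hy, hyd⟩ := hc.exists_infDist_eq_dist hn x
    have hle : infDist x S ≤ dist x y := infDist_le_dist_of_mem hy.1
    rw [hyd]
    refine lt_of_le_of_ne hle fun heq => hy.2 ?_
    rw [← nearestPt_eq hS h hy.1 heq.symm]
    exact hxV
  filter_upwards [(continuous_infDist_pt S).continuousAt.eventually_lt
    (continuous_infDist_pt (S \ V)).continuousAt hlt] with w hw
  by_contra hwV
  have h1 := nearestPt_spec hS hne w
  have := infDist_le_dist_of_mem (x := w) (show nearestPt S w ∈ S \ V from ⟨h1.1, hwV⟩)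
  linarith [h1.2]

/-- The distance to `S` grows at unit rate when moving away from the nearest point. -/
lemma eventually_infDist_add_le (hS : IsCompact S) (hne : S.Nonempty) {z : Euc n}
    (h0 : 0 < infDist z S) (h : infDist z S < uniqRadius S) {μ : ℝ} (hμ0 : 0 ≤ μ) (hμ : μ < 1) :
    ∃ e : Euc n, ‖e‖ = 1 ∧
      ∀ᶠ η : ℝ in 𝓝[>] 0, infDist z S + μ * η ≤ infDist (z + η • e) S := by
  obtain ⟨hq, hqd⟩ := nearestPt_spec hS hne z
  have hnorm : ‖z - nearestPt S z‖ = infDist z S := by rw [← dist_eq_norm, hqd]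
  set e : Euc n := (infDist z S)⁻¹ • (z - nearestPt S z) with he
  have he1 : ‖e‖ = 1 := by
    rw [he, norm_smul, hnorm, norm_inv, Real.norm_of_nonneg h0.le, inv_mul_cancel₀ h0.ne']
  refine ⟨e, he1, ?_⟩
  have hpc := nearestPt_continuousAt hS hne h
  have hg : ContinuousAt (fun w => inner ℝ e (z - nearestPt S w) - μ * ‖z - nearestPt S w‖) z := by
    fun_prop
  have hgz : 0 < inner ℝ e (z - nearestPt S z) - μ * ‖z - nearestPt S z‖ := by
    rw [he, real_inner_smul_left, real_inner_self_eq_norm_sq, hnorm, pow_two,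
      inv_mul_cancel_left₀ h0.ne']
    nlinarith
  have hcurve : Tendsto (fun η : ℝ => z + η • e) (𝓝[>] 0) (𝓝 z) := by
    have : ContinuousAt (fun η : ℝ => z + η • e) 0 := by fun_prop
    simpa [ContinuousAt] using this.tendsto.mono_left nhdsWithin_le_nhds
  filter_upwards [hcurve.eventually (hg.eventually (lt_mem_nhds hgz)), self_mem_nhdsWithin]
    with η hη hpos
  have hpos : 0 < η := hpos
  obtain ⟨hw, hwd⟩ := nearestPt_spec hS hne (z + η • e)
  set v := z - nearestPt S (z + η • e) with hv
  have h1 : infDist z S ≤ ‖v‖ := by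
    rw [hv, ← dist_eq_norm]; exact infDist_le_dist_of_mem hw
  have h2 : infDist (z + η • e) S = ‖v + η • e‖ := by
    rw [← hwd, dist_eq_norm, hv]; congr 1; abel
  have h3 : ‖v + η • e‖ ^ 2 = ‖v‖ ^ 2 + 2 * (η * inner ℝ e v) + η ^ 2 := by
    rw [norm_add_sq_real, real_inner_smul_right, norm_smul, he1, real_inner_comm, mul_one,
      Real.norm_of_nonneg hpos.le]
  rw [h2]
  have h4 : ‖v‖ + μ * η ≤ ‖v + η • e‖ := by
    refine le_of_sq_le_sq ?_ (norm_nonneg _)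
    rw [h3]
    have := mul_lt_mul_of_pos_left hη hpos
    nlinarith [mul_nonneg (sq_nonneg η) (by nlinarith : 0 ≤ 1 - μ ^ 2)]
  linarith

lemma infDist_add_smul_step (hS : IsCompact S) {b v : Euc n} (hb : b ∈ S) (hv : ‖v‖ = 1)
    {τ ε : ℝ} (hε : 0 < ε) (hετ : ε ≤ τ) (hL : τ + ε < uniqRadius S)
    (h : infDist (b + τ • v) S = τ) : infDist (b + (τ + ε) • v) S = τ + ε := by
  have hne : S.Nonempty := ⟨b, hb⟩
  set z := b + τ • v with hz
  have hdc := continuous_infDist_pt S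
  have step : ∀ c : ℝ, 0 ≤ c → c < 1 →
      ∃ w ∈ closedBall z ε, τ + c * ε ≤ infDist w S := by
    intro c hc0 hc1
    obtain ⟨w, hw, hmax⟩ := (isCompact_closedBall z ε).exists_isMaxOn
      ⟨z, mem_closedBall_self hε.le⟩
      (f := fun w => infDist w S - c * dist w z) (by fun_prop)
    have hzw := hmax (mem_closedBall_self hε.le)
    simp only [dist_self, mul_zero, sub_zero, mem_ofPred_eq, h] at hzw
    rcases (mem_closedBall.1 hw).eq_or_lt with heq | hlt
    · exact ⟨w, hw, by rw [heq] at hzw; linarith⟩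
    exfalso
    have hw1 : infDist w S ≤ infDist z S + dist w z := infDist_le_infDist_add_dist
    have hw2 : infDist z S ≤ infDist w S + dist z w := infDist_le_infDist_add_dist
    rw [dist_comm] at hw2
    obtain ⟨e, he, hev⟩ := eventually_infDist_add_le hS hne (z := w) (by linarith) (by linarith)
      (μ := (1 + c) / 2) (by linarith) (by linarith)
    have hcurve : Tendsto (fun η : ℝ => dist (w + η • e) z) (𝓝[>] 0) (𝓝 (dist w z)) := by
      have : ContinuousAt (fun η : ℝ => dist (w + η • e) z) 0 := by fun_prop
      simpa [ContinuousAt] using this.tendsto.mono_left nhdsWithin_le_nhds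
    obtain ⟨η, ⟨h1, h2⟩, h3⟩ :=
      ((hev.and (hcurve.eventually (gt_mem_nhds hlt))).and self_mem_nhdsWithin).exists
    have h3 : 0 < η := h3
    have h4 := hmax (mem_closedBall.2 h2.le)
    simp only [mem_ofPred_eq] at h4
    have h5 : dist (w + η • e) z ≤ η + dist w z := by
      refine (dist_triangle _ w _).trans (add_le_add_left ?_ _)
      rw [dist_eq_norm, add_sub_cancel_left, norm_smul, he, mul_one, Real.norm_of_nonneg h3.le]
    nlinarith [mul_le_mul_of_nonneg_left h5 hc0]
  obtain ⟨w, hw, hmax⟩ := (isCompact_closedBall z ε).exists_isMaxOn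
    ⟨z, mem_closedBall_self hε.le⟩ (f := fun w => infDist w S) hdc.continuousOn
  have hwd : τ + ε ≤ infDist w S := by
    by_contra! hlt
    have h0 : τ ≤ infDist w S := by
      simpa [h] using hmax (mem_closedBall_self hε.le)
    obtain ⟨w', hw', hd⟩ := step ((infDist w S - τ) / ε / 2 + 1 / 2)
      (by have := div_nonneg (sub_nonneg.2 h0) hε.le; linarith)
      (by have : (infDist w S - τ) / ε < 1 := by rw [div_lt_one hε]; linarith
          linarith)
    have h1 := hmax hw'
    simp only [mem_ofPred_eq] at h1
    have : ((infDist w S - τ) / ε / 2 + 1 / 2) * ε = (infDist w S - τ) / 2 + ε / 2 := by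
      field_simp
    linarith
  have hwb : infDist w S ≤ dist w b := infDist_le_dist_of_mem hb
  have hwz : ‖w - z‖ ≤ ε := by rw [← dist_eq_norm]; exact hw
  have hτ : 0 < τ := hε.trans_le hετ
  have hexp : dist w b ^ 2 = ‖w - z‖ ^ 2 + 2 * (τ * inner ℝ (w - z) v) + τ ^ 2 := by
    rw [dist_eq_norm, show w - b = (w - z) + τ • v by rw [hz]; abel, norm_add_sq_real,
      real_inner_smul_right, norm_smul, hv, mul_one, Real.norm_of_nonneg hτ.le]
  have hin : ε ≤ inner ℝ (w - z) v := by
    have h1 : (τ + ε) ^ 2 ≤ dist w b ^ 2 := by gcongr; linarith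
    have h2 : ‖w - z‖ ^ 2 ≤ ε ^ 2 := by gcongr
    by_contra! hlt
    nlinarith
  have hzero : ‖w - z - ε • v‖ ^ 2 ≤ 0 := by
    rw [norm_sub_sq_real, real_inner_smul_right, norm_smul, hv, mul_one,
      Real.norm_of_nonneg hε.le]
    have h2 : ‖w - z‖ ^ 2 ≤ ε ^ 2 := by gcongr
    nlinarith
  have hweq : w = b + (τ + ε) • v := by
    have : w - z - ε • v = 0 := by
      rw [← norm_eq_zero]
      exact pow_eq_zero_iff two_ne_zero |>.1 (le_antisymm hzero (sq_nonneg _))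
    rw [hz] at this
    rw [add_smul, ← sub_eq_zero, ← this]; abel
  rw [← hweq]
  refine le_antisymm (hwb.trans ?_) hwd
  rw [hweq, dist_eq_norm, add_sub_cancel_left, norm_smul, hv, mul_one, Real.norm_of_nonneg
    (by linarith)]

/-- If the nearest point of `b + τ v` is `b` for small `τ > 0`, it remains so up to the uniqueness
radius. -/
lemma infDist_add_smul_of_eventually (hS : IsCompact S) {b v : Euc n} (hb : b ∈ S)
    (hv : ‖v‖ = 1) (h : ∀ᶠ τ : ℝ in 𝓝[>] 0, infDist (b + τ • v) S = τ)
    {τ : ℝ} (hτ : 0 ≤ τ) (hL : τ < uniqRadius S) : infDist (b + τ • v) S = τ := by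
  rcases hτ.eq_or_lt with rfl | hτ
  · simp [infDist_zero_of_mem hb]
  have key : ∀ k : ℕ, infDist (b + (τ / 2 ^ k) • v) S = τ / 2 ^ k →
      infDist (b + τ • v) S = τ := by
    intro k
    induction k with
    | zero => simp
    | succ k ih =>
      intro hk
      apply ih
      have hp : 0 < τ / 2 ^ (k + 1) := by positivity
      have hsum : τ / 2 ^ (k + 1) + τ / 2 ^ (k + 1) = τ / 2 ^ k := by
        rw [pow_succ]; field_simp; ring
      have := infDist_add_smul_step hS hb hv hp le_rfl
        (by rw [hsum]; exact (div_le_self hτ.le (one_le_pow₀ one_le_two)).trans_lt hL) hk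
      rwa [hsum] at this
  have hlim : Tendsto (fun k : ℕ => τ / 2 ^ k) atTop (𝓝[>] 0) := by
    refine tendsto_nhdsWithin_iff.2 ⟨?_, Eventually.of_forall fun k => ?_⟩
    · exact tendsto_const_nhds.div_atTop (tendsto_pow_atTop_atTop_of_one_lt one_lt_two)
    · exact (by positivity : 0 < τ / 2 ^ k)
  obtain ⟨k, hk⟩ := (hlim.eventually h).exists
  exact key k hk

end Metric

section LinearBound

variable {E : Type*} [NormedAddCommGroup E] [InnerProductSpace ℝ E]

lemma norm_sq_sub_inner_smul {N : E} (hN : ‖N‖ = 1) (u : E) :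
    ‖u - inner ℝ N u • N‖ ^ 2 + inner ℝ N u ^ 2 = ‖u‖ ^ 2 := by
  rw [norm_sub_sq_real, real_inner_smul_right, norm_smul, hN, mul_one, Real.norm_eq_abs, sq_abs,
    real_inner_comm]
  ring

lemma inner_sub_inner_smul {N : E} (hN : ‖N‖ = 1) (u : E) :
    inner ℝ N (u - inner ℝ N u • N) = 0 := by
  rw [inner_sub_right, real_inner_smul_right, real_inner_self_eq_norm_sq, hN]
  ring

lemma norm_le_of_abs_inner_self_le {H : E →L[ℝ] E} {L : ℝ} (hL : 0 < L)
    (hsymm : ∀ u v, inner ℝ (H u) v = inner ℝ u (H v))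
    (h : ∀ u, L * |inner ℝ (H u) u| ≤ ‖u‖ ^ 2) (u : E) : L * ‖H u‖ ≤ ‖u‖ := by
  have h1 := h (u + L • H u)
  have h2 := h (u - L • H u)
  have h3 := le_abs_self (inner ℝ (H (u + L • H u)) (u + L • H u))
  have h4 := neg_abs_le (inner ℝ (H (u - L • H u)) (u - L • H u))
  have hpar := parallelogram_law_with_norm ℝ u (L • H u)
  have hdiff : inner ℝ (H (u + L • H u)) (u + L • H u) -
      inner ℝ (H (u - L • H u)) (u - L • H u) = 4 * (L * ‖H u‖ ^ 2) := by
    have e1 : inner ℝ (H (H u)) u = ‖H u‖ ^ 2 := by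
      rw [hsymm, real_inner_self_eq_norm_sq]
    simp only [map_add, map_sub, map_smul, inner_add_left, inner_add_right, inner_sub_left,
      inner_sub_right, real_inner_smul_left, real_inner_smul_right, real_inner_self_eq_norm_sq, e1]
    ring
  have hn : ‖L • H u‖ = L * ‖H u‖ := by rw [norm_smul, Real.norm_of_nonneg hL.le]
  rw [hn] at hpar
  refine le_of_sq_le_sq ?_ (norm_nonneg _)
  have := mul_le_mul_of_nonneg_left h3 hL.le
  have := mul_le_mul_of_nonneg_left h4 hL.le
  nlinarith

/-- The algebraic estimate behind the bound on the second differential of the projection. -/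
lemma norm_secondDifferential_le [FiniteDimensional ℝ E] {N : E} (hN : ‖N‖ = 1)
    {H P : E →L[ℝ] E} {W D : E →L[ℝ] E →L[ℝ] E} {L t : ℝ} (hL : 0 < L) (ht : |t| ≤ L / 2)
    (hsymm : ∀ u v, inner ℝ (H u) v = inner ℝ u (H v)) (hHN : H N = 0)
    (hH : ∀ u, L * ‖H u‖ ≤ ‖u‖)
    (hP : ∀ u, P (u + t • H u) = u - inner ℝ N u • N)
    (hD : ∀ u v, D (u + t • H u) (v + t • H v) + P (t • W u v) =
      -(inner ℝ (H u) v • N + inner ℝ N v • H u + inner ℝ N u • H v)) :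
    ‖D‖ ≤ 8 * max L⁻¹ (L * ‖W‖) := by
  set M := max L⁻¹ (L * ‖W‖) with hM
  have hM1 : L⁻¹ ≤ M := le_max_left _ _
  have hM2 : L * ‖W‖ ≤ M := le_max_right _ _
  have hLi : 0 < L⁻¹ := inv_pos.2 hL
  have hM0 : 0 ≤ M := hLi.le.trans hM1
  have hNH : ∀ u, inner ℝ N (H u) = 0 := fun u => by rw [← hsymm, hHN, inner_zero_left]
  have hH' : ∀ u, ‖H u‖ ≤ L⁻¹ * ‖u‖ := fun u => by
    rw [inv_mul_eq_div, le_div_iff₀ hL, mul_comm]; exact hH u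
  have hGle : ∀ u, ‖u‖ ≤ 2 * ‖u + t • H u‖ := by
    intro u
    have h1 : ‖t • H u‖ ≤ ‖u‖ / 2 := by
      rw [norm_smul, Real.norm_eq_abs]
      have := mul_le_mul_of_nonneg_right ht (norm_nonneg (H u))
      linarith [hH u]
    have h2 : ‖u‖ ≤ ‖u + t • H u‖ + ‖t • H u‖ := by
      simpa using norm_sub_le (u + t • H u) (t • H u)
    linarith
  have hGsurj : Function.Surjective fun u => u + t • H u := by
    let G : E →ₗ[ℝ] E := LinearMap.id + t • (H : E →ₗ[ℝ] E)
    have : Function.Injective G := by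
      rw [← LinearMap.ker_eq_bot, LinearMap.ker_eq_bot']
      intro u hu
      have hu : u + t • H u = 0 := hu
      have := hGle u
      rw [hu, norm_zero, mul_zero] at this
      exact norm_le_zero_iff.1 this
    exact LinearMap.injective_iff_surjective.1 this
  have hPle : ∀ w, ‖P w‖ ≤ 2 * ‖w‖ := by
    intro w
    obtain ⟨u, rfl⟩ := hGsurj w
    refine le_trans ?_ (hGle u)
    rw [hP]
    refine le_of_sq_le_sq ?_ (norm_nonneg _)
    nlinarith [norm_sq_sub_inner_smul hN u]
  have hNP : ∀ w, inner ℝ N (P w) = 0 := by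
    intro w
    obtain ⟨u, rfl⟩ := hGsurj w
    simp only [hP]
    exact inner_sub_inner_smul hN u
  have hNG : ∀ u, inner ℝ N (u + t • H u) = inner ℝ N u := fun u => by
    rw [inner_add_right, real_inner_smul_right, hNH, mul_zero, add_zero]
  have hHT : ∀ u, ‖H u‖ ≤ L⁻¹ * (2 * ‖u + t • H u - inner ℝ N (u + t • H u) • N‖) := by
    intro u
    have h1 : H (u - inner ℝ N u • N) = H u := by simp [hHN]
    have h2 := hGle (u - inner ℝ N u • N)
    rw [h1] at h2
    rw [hNG]
    refine (h1 ▸ hH' (u - inner ℝ N u • N)).trans (mul_le_mul_of_nonneg_left (h2.trans_eq ?_) hLi.le)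
    congr 2; abel
  refine D.opNorm_le_bound₂ (by positivity) fun u' v' => ?_
  obtain ⟨u, rfl⟩ := hGsurj u'
  obtain ⟨v, rfl⟩ := hGsurj v'
  simp only
  set u' := u + t • H u with hu'
  set v' := v + t • H v with hv'
  have hD' := eq_sub_of_add_eq (hD u v)
  set X := inner ℝ (H u) v with hX
  set Y := -(inner ℝ N v • H u + inner ℝ N u • H v) - P (t • W u v) with hY
  have hDXY : D u' v' = Y - X • N := by rw [hD', hY]; abel
  have hNY : inner ℝ Y N = 0 := by
    rw [real_inner_comm, hY, inner_sub_right, hNP, inner_neg_right, inner_add_right,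
      real_inner_smul_right, real_inner_smul_right, hNH, hNH]
    ring
  have hu0 := norm_nonneg u'
  have hv0 := norm_nonneg v'
  have hXle : |X| ≤ 4 * M * (‖u'‖ * ‖v'‖) := by
    calc |X| ≤ ‖H u‖ * ‖v‖ := abs_real_inner_le_norm _ _
      _ ≤ (L⁻¹ * (2 * ‖u'‖)) * (2 * ‖v'‖) := by
        gcongr
        · exact (hH' u).trans (mul_le_mul_of_nonneg_left (hGle u) hLi.le)
        · exact hGle v
      _ = 4 * L⁻¹ * (‖u'‖ * ‖v'‖) := by ring
      _ ≤ _ := by gcongr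
  have hmix : ‖inner ℝ N v • H u + inner ℝ N u • H v‖ ≤ 2 * M * (‖u'‖ * ‖v'‖) := by
    have hu2 := norm_sq_sub_inner_smul hN u'
    have hv2 := norm_sq_sub_inner_smul hN v'
    have h1 := hHT u
    have h2 := hHT v
    rw [← hu'] at h1
    rw [← hv'] at h2
    rw [← hNG u, ← hNG v, ← hu', ← hv']
    set α := ‖u' - inner ℝ N u' • N‖
    set β := ‖v' - inner ℝ N v' • N‖
    have hcs : |inner ℝ N v'| * α + |inner ℝ N u'| * β ≤ ‖u'‖ * ‖v'‖ := by
      refine le_of_sq_le_sq ?_ (by positivity)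
      rw [mul_pow, ← hu2, ← hv2, ← sq_abs (inner ℝ N u'), ← sq_abs (inner ℝ N v')]
      nlinarith [sq_nonneg (α * β - |inner ℝ N u'| * |inner ℝ N v'|)]
    calc ‖inner ℝ N v' • H u + inner ℝ N u' • H v‖
        ≤ |inner ℝ N v'| * ‖H u‖ + |inner ℝ N u'| * ‖H v‖ := by
          refine (norm_add_le _ _).trans_eq ?_
          rw [norm_smul, norm_smul, Real.norm_eq_abs, Real.norm_eq_abs]
      _ ≤ |inner ℝ N v'| * (L⁻¹ * (2 * α)) + |inner ℝ N u'| * (L⁻¹ * (2 * β)) := by gcongr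
      _ = 2 * L⁻¹ * (|inner ℝ N v'| * α + |inner ℝ N u'| * β) := by ring
      _ ≤ 2 * M * (‖u'‖ * ‖v'‖) := by gcongr
  have hPW : ‖P (t • W u v)‖ ≤ 4 * M * (‖u'‖ * ‖v'‖) := by
    calc ‖P (t • W u v)‖ ≤ 2 * (|t| * ‖W u v‖) := by
          refine (hPle _).trans_eq ?_
          rw [norm_smul, Real.norm_eq_abs]
      _ ≤ 2 * (L / 2 * (‖W‖ * (2 * ‖u'‖) * (2 * ‖v'‖))) := by
          gcongr
          refine (W.le_opNorm₂ u v).trans ?_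
          gcongr
          · exact hGle u
          · exact hGle v
      _ = 4 * (L * ‖W‖) * (‖u'‖ * ‖v'‖) := by ring
      _ ≤ _ := by gcongr
  have hYle : ‖Y‖ ≤ 6 * M * (‖u'‖ * ‖v'‖) := by
    have := norm_sub_le (-(inner ℝ N v • H u + inner ℝ N u • H v)) (P (t • W u v))
    rw [norm_neg, ← hY] at this
    linarith
  rw [hDXY, mul_assoc]
  refine le_of_sq_le_sq ?_ (by positivity)
  rw [norm_sub_sq_real, real_inner_smul_right, hNY, norm_smul, hN, Real.norm_eq_abs]
  have h1 := pow_le_pow_left₀ (abs_nonneg X) hXle 2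
  have h2 := pow_le_pow_left₀ (norm_nonneg Y) hYle 2
  nlinarith [sq_nonneg (M * (‖u'‖ * ‖v'‖))]

end LinearBound

section Differential

variable {E : Type*} [NormedAddCommGroup E] [InnerProductSpace ℝ E]

lemma exists_contDiffAt_local_inverse {F : Type*} [NormedAddCommGroup F] [NormedSpace ℝ F]
    [FiniteDimensional ℝ F] {Φ : F → F} {a : F} {A : F →L[ℝ] F} (hΦ : ContDiffAt ℝ 2 Φ a)
    (hA : HasFDerivAt Φ A a) (hinj : ∀ u, A u = 0 → u = 0) :
    ∃ g : F → F, ContDiffAt ℝ 2 g (Φ a) ∧ g (Φ a) = a ∧ (∀ᶠ y in 𝓝 a, g (Φ y) = y) ∧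
      ∀ᶠ z in 𝓝 (Φ a), Φ (g z) = z := by
  have : CompleteSpace F := FiniteDimensional.complete ℝ F
  have hinj' : Function.Injective (A : F →ₗ[ℝ] F) := by
    rw [← LinearMap.ker_eq_bot, LinearMap.ker_eq_bot']
    exact hinj
  let A' : F ≃L[ℝ] F := (LinearEquiv.ofInjectiveEndo (A : F →ₗ[ℝ] F) hinj').toContinuousLinearEquiv
  have hA' : HasFDerivAt Φ (A' : F →L[ℝ] F) a := by
    convert hA using 1
    ext u
    rfl
  have hs : HasStrictFDerivAt Φ (A' : F →L[ℝ] F) a := hΦ.hasStrictFDerivAt' hA' two_ne_zero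
  exact ⟨hΦ.localInverse hA' two_ne_zero, hΦ.to_localInverse hA' two_ne_zero,
    hΦ.localInverse_apply_image hA' two_ne_zero, hs.eventually_left_inverse,
    hs.eventually_right_inverse⟩

section SignedDistance

variable {N π : E → E} {s : E → ℝ} {a : E}

lemma inner_fderiv_eq_zero_of_norm_eq_one {z : E} (hN : DifferentiableAt ℝ N z)
    (h1 : ∀ᶠ w in 𝓝 z, ‖N w‖ = 1) (v : E) : inner ℝ (N z) (fderiv ℝ N z v) = 0 := by
  have hd : HasFDerivAt (fun w => inner ℝ (N w) (N w)) _ z :=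
    hN.hasFDerivAt.inner ℝ hN.hasFDerivAt
  have hc : (fun w => inner ℝ (N w) (N w)) =ᶠ[𝓝 z] fun _ => (1 : ℝ) := by
    filter_upwards [h1] with w hw
    rw [real_inner_self_eq_norm_sq, hw, one_pow]
  have := congrArg (fun T => T v)
    ((hd.congr_of_eventuallyEq hc.symm).unique (hasFDerivAt_const (1 : ℝ) z))
  simp [real_inner_comm (N z)] at this
  linarith [real_inner_comm (N z) (fderiv ℝ N z v)]

lemma inner_fderiv_normal_symm (hs : ContDiffAt ℝ 2 s a) (hN : ContDiffAt ℝ 2 N a)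
    (hds : ∀ᶠ z in 𝓝 a, ∀ v, fderiv ℝ s z v = inner ℝ (N z) v) (u v : E) :
    inner ℝ (fderiv ℝ N a u) v = inner ℝ u (fderiv ℝ N a v) := by
  have hd : DifferentiableAt ℝ N a := hN.differentiableAt two_ne_zero
  have h2 : HasFDerivAt (fderiv ℝ s) ((innerSL ℝ).comp (fderiv ℝ N a)) a := by
    refine HasFDerivAt.congr_of_eventuallyEq
      ((innerSL ℝ (E := E)).hasFDerivAt.comp a hd.hasFDerivAt) ?_
    filter_upwards [hds] with z hz
    ext w
    exact hz w
  have := (hs.isSymmSndFDerivAt (by simp)).eq u v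
  rw [h2.fderiv] at this
  simpa [real_inner_comm] using this

lemma eventually_fderiv_proj (hs : ContDiffAt ℝ 2 s a) (hN : ContDiffAt ℝ 2 N a)
    (hds : ∀ᶠ z in 𝓝 a, ∀ v, fderiv ℝ s z v = inner ℝ (N z) v)
    (hπ : ∀ᶠ z in 𝓝 a, π z = z - s z • N z) :
    ∀ᶠ z in 𝓝 a, fderiv ℝ π z = ContinuousLinearMap.id ℝ E -
      (s z • fderiv ℝ N z + (innerSL ℝ (N z)).smulRight (N z)) := by
  filter_upwards [hds, hπ.eventually_nhds, hs.eventually (by simp), hN.eventually (by simp)]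
    with z h1 h2 h3 h4
  have h3' := (h3.differentiableAt two_ne_zero).hasFDerivAt
  have h4' := (h4.differentiableAt two_ne_zero).hasFDerivAt
  have : HasFDerivAt π _ z := ((hasFDerivAt_id z).sub (h3'.smul h4')).congr_of_eventuallyEq h2
  rw [this.fderiv]
  ext v
  simp [h1]

lemma fderiv_fderiv_proj (hs : ContDiffAt ℝ 2 s a) (hN : ContDiffAt ℝ 2 N a) (hsa : s a = 0)
    (hds : ∀ᶠ z in 𝓝 a, ∀ v, fderiv ℝ s z v = inner ℝ (N z) v)
    (hπ : ∀ᶠ z in 𝓝 a, π z = z - s z • N z) (u v : E) :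
    fderiv ℝ (fderiv ℝ π) a u v = -(inner ℝ (fderiv ℝ N a u) v • N a +
      inner ℝ (N a) v • fderiv ℝ N a u + inner ℝ (N a) u • fderiv ℝ N a v) := by
  have hs' := (hs.differentiableAt two_ne_zero).hasFDerivAt
  have hN' := (hN.differentiableAt two_ne_zero).hasFDerivAt
  have hN2 : HasFDerivAt (fderiv ℝ N) (fderiv ℝ (fderiv ℝ N) a) a :=
    ((hN.fderiv_right (m := 1) (by norm_num)).differentiableAt one_ne_zero).hasFDerivAt
  have hπ2 : DifferentiableAt ℝ (fderiv ℝ π) a := by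
    have : ContDiffAt ℝ 2 π a := (contDiffAt_id.sub (hs.smul hN)).congr_of_eventuallyEq hπ
    exact (this.fderiv_right (m := 1) (by norm_num)).differentiableAt one_ne_zero
  have h1 : HasFDerivAt (fun z => fderiv ℝ π z v)
      ((ContinuousLinearMap.apply ℝ E v).comp (fderiv ℝ (fderiv ℝ π) a)) a :=
    (ContinuousLinearMap.apply ℝ E v).hasFDerivAt.comp a hπ2.hasFDerivAt
  have hNv : HasFDerivAt (fun z => fderiv ℝ N z v)
      ((ContinuousLinearMap.apply ℝ E v).comp (fderiv ℝ (fderiv ℝ N) a)) a :=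
    (ContinuousLinearMap.apply ℝ E v).hasFDerivAt.comp a hN2
  have h2 : HasFDerivAt (fun z => v - (s z • fderiv ℝ N z v + inner ℝ (N z) v • N z)) _ a :=
    (hasFDerivAt_const v a).sub
      ((hs'.smul hNv).add ((hN'.inner ℝ (hasFDerivAt_const v a)).smul hN'))
  have heq : (fun z => fderiv ℝ π z v) =ᶠ[𝓝 a]
      fun z => v - (s z • fderiv ℝ N z v + inner ℝ (N z) v • N z) := by
    filter_upwards [eventually_fderiv_proj hs hN hds hπ] with z hz
    simp [hz]
  have := congrArg (fun T => T u) (h1.unique (h2.congr_of_eventuallyEq heq))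
  simp only [ContinuousLinearMap.comp_apply, ContinuousLinearMap.apply_apply] at this
  rw [this]
  simp [hsa, hds.self_of_nhds]
  abel

end SignedDistance

/-- Second-order chain rule for `π ∘ G = π`. -/
lemma fderiv_fderiv_comp {π ρ G : E → E} {a : E} (hG : ContDiffAt ℝ 2 G a)
    (hπ : ContDiffAt ℝ 2 π (G a)) (h : ∀ᶠ y in 𝓝 a, π (G y) = ρ y) (u v : E) :
    fderiv ℝ (fderiv ℝ ρ) a u v =
      fderiv ℝ (fderiv ℝ π) (G a) (fderiv ℝ G a u) (fderiv ℝ G a v) +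
        fderiv ℝ π (G a) (fderiv ℝ (fderiv ℝ G) a u v) := by
  have hG2 : HasFDerivAt (fderiv ℝ G) (fderiv ℝ (fderiv ℝ G) a) a :=
    ((hG.fderiv_right (m := 1) (by norm_num)).differentiableAt one_ne_zero).hasFDerivAt
  have hπ2 : HasFDerivAt (fderiv ℝ π) (fderiv ℝ (fderiv ℝ π) (G a)) (G a) :=
    ((hπ.fderiv_right (m := 1) (by norm_num)).differentiableAt one_ne_zero).hasFDerivAt
  have h1 : fderiv ℝ ρ =ᶠ[𝓝 a] fun y => (fderiv ℝ π (G y)).comp (fderiv ℝ G y) := by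
    filter_upwards [h.eventually_nhds, hG.eventually (by simp),
      hG.continuousAt.eventually (hπ.eventually (by simp))] with y h1 h2 h3
    have : HasFDerivAt ρ _ y := ((h3.differentiableAt two_ne_zero).hasFDerivAt.comp y
      (h2.differentiableAt two_ne_zero).hasFDerivAt).congr_of_eventuallyEq
        (h1.mono fun _ hy => hy.symm)
    exact this.fderiv
  have h2 : HasFDerivAt (fun y => (fderiv ℝ π (G y)).comp (fderiv ℝ G y)) _ a :=
    (hπ2.comp a (hG.differentiableAt two_ne_zero).hasFDerivAt).clm_comp hG2
  rw [(h2.congr_of_eventuallyEq h1).fderiv]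
  simp [add_comm]

end Differential

namespace CkDomain

variable {n : ℕ} {U : Set (Euc n)} (B : CkDomain n 3 U)

lemma contDiffAt_f {y : Euc n} (hy : y ∈ B.O) : ContDiffAt ℝ 3 B.f y :=
  B.smooth.contDiffAt (B.opO.mem_nhds hy)

lemma contDiffAt_gradient {y : Euc n} (hy : y ∈ B.O) : ContDiffAt ℝ 2 (gradient B.f) y :=
  (InnerProductSpace.toDual ℝ (Euc n)).symm.contDiff.contDiffAt.comp y
    ((B.contDiffAt_f hy).fderiv_right (by norm_num))

lemma norm_nu {y : Euc n} (hy : gradient B.f y ≠ 0) : ‖B.nu y‖ = 1 := by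
  rw [nu, norm_smul, norm_inv, norm_norm, inv_mul_cancel₀ (norm_ne_zero_iff.2 hy)]

lemma norm_smul_nu {y : Euc n} (hy : gradient B.f y ≠ 0) :
    ‖gradient B.f y‖ • B.nu y = gradient B.f y := by
  rw [nu, smul_smul, mul_inv_cancel₀ (norm_ne_zero_iff.2 hy), one_smul]

lemma contDiffAt_nu {y : Euc n} (hy : y ∈ B.O) (h : gradient B.f y ≠ 0) :
    ContDiffAt ℝ 2 B.nu y := by
  have := B.contDiffAt_gradient hy
  exact ((this.norm ℝ h).inv (norm_ne_zero_iff.2 h)).smul this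

lemma mem_frontier_of_eq_zero (hU : IsOpen U) {y : Euc n} (hy : y ∈ B.O) (h : B.f y = 0) :
    y ∈ frontier U := by
  rw [hU.frontier_eq]
  refine ⟨?_, fun hyU => (B.neg y ⟨hy, hyU⟩).ne h⟩
  by_contra hc
  exact (B.pos y ⟨hy, hc⟩).ne' h

/-- A displacement from a nearest point of the boundary is normal to the boundary. -/
lemma sub_eq_inner_smul_nu (hU : IsOpen U) {z q : Euc n} (hq : q ∈ frontier U)
    (hz : dist z q = infDist z (frontier U)) :
    z - q = inner ℝ (z - q) (B.nu q) • B.nu q := by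
  have hqO := B.front hq
  have hmin : IsLocalExtrOn (fun y => ‖z - y‖ ^ 2) {y | B.f y = B.f q} q := by
    refine IsMinFilter.isExtr ?_
    have hO : ∀ᶠ y in 𝓝[{y | B.f y = B.f q}] q, y ∈ B.O :=
      nhdsWithin_le_nhds (B.opO.mem_nhds hqO)
    filter_upwards [hO, self_mem_nhdsWithin] with y hy hfy
    have hyS : y ∈ frontier U := B.mem_frontier_of_eq_zero hU hy (hfy.trans (B.zero q hq))
    have := infDist_le_dist_of_mem (x := z) hyS
    rw [← hz, dist_eq_norm, dist_eq_norm] at this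
    gcongr
  have hφ : HasStrictFDerivAt (fun y => ‖z - y‖ ^ 2) _ q :=
    (hasStrictFDerivAt_norm_sq (z - q)).comp q ((hasStrictFDerivAt_id q).const_sub z)
  obtain ⟨c, d, hcd, h⟩ := hmin.exists_multipliers_of_hasStrictFDerivAt_1d
    ((B.contDiffAt_f hqO).hasStrictFDerivAt three_ne_zero) hφ
  have hg := B.grad_ne q hq
  have hv : ∀ v, c * inner ℝ (gradient B.f q) v - 2 * d * inner ℝ (z - q) v = 0 := by
    intro v
    have := congrArg (fun T => T v) h
    rw [inner_gradient_left]
    simp at this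
    simp only [inner_sub_left]
    linarith
  have hd : d ≠ 0 := by
    rintro rfl
    have h1 := hv (gradient B.f q)
    rw [real_inner_self_eq_norm_sq] at h1
    have : c = 0 := by simpa [hg] using h1
    exact hcd (by rw [this]; rfl)
  have heq : z - q = (c / (2 * d) * ‖gradient B.f q‖) • B.nu q := by
    rw [mul_smul, B.norm_smul_nu hg]
    refine ext_inner_right ℝ fun v => ?_
    rw [real_inner_smul_left]
    field_simp
    linarith [hv v]
  have : inner ℝ (z - q) (B.nu q) = c / (2 * d) * ‖gradient B.f q‖ := by
    conv_lhs => rw [heq]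
    rw [real_inner_smul_left, real_inner_self_eq_norm_sq, B.norm_nu hg]
    ring
  rw [this, ← heq]

/-- Normal coordinates around a boundary point. -/
lemma exists_normal_coordinates (hU : IsOpen U) (hc : IsCompact (frontier U)) {a : Euc n}
    (ha : a ∈ frontier U) :
    ContDiffAt ℝ 2 (nearestPt (frontier U)) a ∧
    (∃ s : Euc n → ℝ, ContDiffAt ℝ 2 s a ∧ s a = 0 ∧
      ∀ᶠ z in 𝓝 a, z = nearestPt (frontier U) z + s z • B.nuGeo z) ∧
    ∀ᶠ τ : ℝ in 𝓝 0, nearestPt (frontier U) (a + τ • B.nu a) = a := by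
  have hne : (frontier U).Nonempty := ⟨a, ha⟩
  have haO := B.front ha
  have hg := B.grad_ne a ha
  have hν := B.contDiffAt_nu haO hg
  let Ψ : Euc n × ℝ → Euc n × ℝ := fun p => (p.1 + p.2 • B.nu p.1, B.f p.1)
  have hΨa : Ψ (a, 0) = (a, 0) := by simp [Ψ, B.zero a ha]
  have hΨ : ContDiffAt ℝ 2 Ψ (a, 0) := by
    have h1 : ContDiffAt ℝ 2 (fun p : Euc n × ℝ => B.nu p.1) (a, 0) :=
      ContDiffAt.comp (a, (0 : ℝ)) (f := Prod.fst) hν contDiffAt_fst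
    have h2 : ContDiffAt ℝ 2 (fun p : Euc n × ℝ => B.f p.1) (a, 0) :=
      ContDiffAt.comp (a, (0 : ℝ)) (f := Prod.fst)
        ((B.contDiffAt_f haO).of_le (by norm_num)) contDiffAt_fst
    exact (contDiffAt_fst.add (contDiffAt_snd.smul h1)).prodMk h2
  have hνd : HasFDerivAt B.nu (fderiv ℝ B.nu a) a :=
    (hν.differentiableAt two_ne_zero).hasFDerivAt
  have hfd : HasFDerivAt B.f (fderiv ℝ B.f a) a :=
    ((B.contDiffAt_f haO).differentiableAt three_ne_zero).hasFDerivAt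
  have hfst : HasFDerivAt (Prod.fst : Euc n × ℝ → Euc n) (ContinuousLinearMap.fst ℝ _ _) (a, 0) :=
    hasFDerivAt_fst
  have hsnd : HasFDerivAt (Prod.snd : Euc n × ℝ → ℝ) (ContinuousLinearMap.snd ℝ _ _) (a, 0) :=
    hasFDerivAt_snd
  have hΨ' : HasFDerivAt Ψ _ (a, 0) :=
    (hfst.add (hsnd.smul (HasFDerivAt.comp (a, (0 : ℝ)) (f := Prod.fst) hνd hfst))).prodMk
      (HasFDerivAt.comp (a, (0 : ℝ)) (f := Prod.fst) hfd hfst)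
  obtain ⟨g, hgc, hga, hgl, -⟩ := exists_contDiffAt_local_inverse hΨ hΨ' (by
    rintro ⟨v, τ⟩ h
    have h1 := congrArg Prod.fst h
    have h2 := congrArg Prod.snd h
    simp only [ContinuousLinearMap.prod_apply, ContinuousLinearMap.comp_apply,
      add_apply, ContinuousLinearMap.smulRight_apply,
      ContinuousLinearMap.coe_fst', ContinuousLinearMap.coe_snd', zero_smul, zero_add,
      Function.comp_apply, Prod.fst_zero, Prod.snd_zero, ← inner_gradient_left] at h1 h2
    have hv : v = -(τ • B.nu a) := eq_neg_of_add_eq_zero_left h1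
    rw [hv, ← B.norm_smul_nu hg, inner_neg_right, real_inner_smul_left, real_inner_smul_right,
      real_inner_self_eq_norm_sq, B.norm_nu hg] at h2
    have hτ : τ = 0 := by simpa [hg] using h2
    simp [hv, hτ])
  rw [hΨa] at hgc hga
  set q := nearestPt (frontier U) with hq
  let c : Euc n → ℝ := fun z => inner ℝ (z - q z) (B.nu (q z))
  have hqs := fun z => nearestPt_spec hc hne z
  have hqd : ∀ z, dist z (q z) ≤ dist z a := fun z =>
    (hqs z).2.trans_le (infDist_le_dist_of_mem ha)
  have hzc : ∀ z, z = q z + c z • B.nu (q z) := fun z => by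
    have := B.sub_eq_inner_smul_nu hU (hqs z).1 (hqs z).2
    rw [← this]; abel
  have hda : Tendsto (fun z => dist z a) (𝓝 a) (𝓝 0) := by
    simpa using (continuous_id.dist continuous_const : Continuous fun z : Euc n => dist z a).tendsto a
  have hqt : Tendsto q (𝓝 a) (𝓝 a) := by
    rw [tendsto_iff_dist_tendsto_zero]
    refine squeeze_zero (fun _ => dist_nonneg) (fun z => ?_)
      (by simpa using hda.add hda)
    have := dist_triangle (q z) z a
    rw [dist_comm (q z) z] at this
    linarith [hqd z]
  have hct : Tendsto c (𝓝 a) (𝓝 0) := by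
    refine squeeze_zero_norm (fun z => ?_) hda
    refine (norm_inner_le_norm _ _).trans ?_
    rw [B.norm_nu (B.grad_ne _ (hqs z).1), mul_one, ← dist_eq_norm]
    exact hqd z
  have hgq : ∀ᶠ z in 𝓝 a, g (z, 0) = (q z, c z) := by
    filter_upwards [(hqt.prodMk_nhds hct).eventually hgl] with z hz
    have : Ψ (q z, c z) = (z, 0) := by
      simp only [Ψ, ← hzc z]
      rw [B.zero _ (hqs z).1]
    rwa [this] at hz
  have hG : ContDiffAt ℝ 2 (fun z : Euc n => g (z, 0)) a :=
    ContDiffAt.comp a (f := fun z : Euc n => (z, (0 : ℝ))) hgc (contDiffAt_id.prodMk contDiffAt_const)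
  refine ⟨?_, ⟨fun z => (g (z, 0)).2, contDiffAt_snd.comp a hG, by simp [hga], ?_⟩, ?_⟩
  · refine (contDiffAt_fst.comp a hG).congr_of_eventuallyEq ?_
    filter_upwards [hgq] with z hz
    simp [hz]
  · filter_upwards [hgq] with z hz
    rw [hz]
    exact hzc z
  · have h1 : Tendsto (fun τ : ℝ => (a, τ)) (𝓝 0) (𝓝 (a, 0)) :=
      tendsto_const_nhds.prodMk_nhds tendsto_id
    have h2 : Tendsto (fun τ : ℝ => a + τ • B.nu a) (𝓝 0) (𝓝 a) := by
      have : Continuous fun τ : ℝ => a + τ • B.nu a := by fun_prop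
      simpa using this.tendsto 0
    filter_upwards [h1.eventually hgl, h2.eventually hgq] with τ hτ1 hτ2
    have : Ψ (a, τ) = (a + τ • B.nu a, 0) := by simp [Ψ, B.zero a ha]
    rw [this, hτ2] at hτ1
    exact congrArg Prod.fst hτ1

lemma infDist_add_smul_nu (hU : IsOpen U) (hc : IsCompact (frontier U)) {a : Euc n}
    (ha : a ∈ frontier U) {t : ℝ} (ht : |t| < uniqRadius (frontier U)) :
    infDist (a + t • B.nu a) (frontier U) = |t| := by
  obtain ⟨-, -, h⟩ := B.exists_normal_coordinates hU hc ha
  have hne : (frontier U).Nonempty := ⟨a, ha⟩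
  have hn := B.norm_nu (B.grad_ne a ha)
  have h0 : ∀ᶠ τ : ℝ in 𝓝 0, infDist (a + τ • B.nu a) (frontier U) = |τ| := by
    filter_upwards [h] with τ hτ
    rw [← (nearestPt_spec hc hne _).2, hτ, dist_eq_norm, add_sub_cancel_left, norm_smul, hn,
      mul_one, Real.norm_eq_abs]
  have hneg : Tendsto (fun τ : ℝ => -τ) (𝓝 0) (𝓝 0) := by
    simpa using (continuous_neg : Continuous fun τ : ℝ => -τ).tendsto 0
  rcases le_total 0 t with h1 | h1
  · rw [abs_of_nonneg h1] at ht ⊢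
    refine infDist_add_smul_of_eventually hc ha hn ?_ h1 ht
    filter_upwards [nhdsWithin_le_nhds h0, self_mem_nhdsWithin] with τ hτ hpos
    rw [hτ, abs_of_pos hpos]
  · rw [abs_of_nonpos h1] at ht ⊢
    have := infDist_add_smul_of_eventually hc (v := -B.nu a) ha (by rwa [norm_neg]) ?_
      (neg_nonneg.2 h1) ht
    · rwa [smul_neg, neg_smul, neg_neg] at this
    filter_upwards [nhdsWithin_le_nhds (hneg.eventually h0), self_mem_nhdsWithin] with τ hτ hpos
    rw [smul_neg, ← neg_smul, hτ, abs_neg, abs_of_pos hpos]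

lemma nearestPt_add_smul_nu (hU : IsOpen U) (hc : IsCompact (frontier U)) {a : Euc n}
    (ha : a ∈ frontier U) {t : ℝ} (ht : |t| < uniqRadius (frontier U)) :
    nearestPt (frontier U) (a + t • B.nu a) = a := by
  have h := B.infDist_add_smul_nu hU hc ha ht
  refine nearestPt_eq hc (h.trans_lt ht) ha ?_
  rw [h, dist_eq_norm, add_sub_cancel_left, norm_smul, B.norm_nu (B.grad_ne a ha), mul_one,
    Real.norm_eq_abs]

/-- The two-sided tangent ball condition. -/
lemma two_mul_abs_inner_nu_le (hU : IsOpen U) (hc : IsCompact (frontier U)) {a y : Euc n}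
    (ha : a ∈ frontier U) (hy : y ∈ frontier U) :
    2 * uniqRadius (frontier U) * |inner ℝ (B.nu a) (y - a)| ≤ ‖y - a‖ ^ 2 := by
  have hn := B.norm_nu (B.grad_ne a ha)
  have key : ∀ t : ℝ, |t| < uniqRadius (frontier U) →
      2 * t * inner ℝ (B.nu a) (y - a) ≤ ‖y - a‖ ^ 2 := by
    intro t ht
    have h1 : |t| ≤ dist (a + t • B.nu a) y :=
      (B.infDist_add_smul_nu hU hc ha ht).symm.trans_le (infDist_le_dist_of_mem hy)
    have h2 := pow_le_pow_left₀ (abs_nonneg t) h1 2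
    rw [sq_abs, dist_comm, dist_eq_norm, show y - (a + t • B.nu a) = (y - a) - t • B.nu a by abel,
      norm_sub_sq_real, real_inner_smul_right, norm_smul, hn, mul_one, Real.norm_eq_abs, sq_abs,
      real_inner_comm] at h2
    linarith
  rcases le_or_gt (uniqRadius (frontier U)) 0 with hL | hL
  · nlinarith [abs_nonneg (inner ℝ (B.nu a) (y - a)), sq_nonneg ‖y - a‖,
      mul_nonneg (neg_nonneg.2 hL) (abs_nonneg (inner ℝ (B.nu a) (y - a)))]
  refine le_of_tendsto (x := 𝓝[<] uniqRadius (frontier U))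
    (f := fun t : ℝ => 2 * t * |inner ℝ (B.nu a) (y - a)|) ?_ ?_
  · have : Continuous fun t : ℝ => 2 * t * |inner ℝ (B.nu a) (y - a)| := by fun_prop
    exact (this.tendsto _).mono_left nhdsWithin_le_nhds
  · filter_upwards [Ioo_mem_nhdsLT hL] with t ht
    rcases abs_cases (inner ℝ (B.nu a) (y - a)) with h | h
    · rw [h.1]
      exact key t (by rw [abs_of_pos ht.1]; exact ht.2)
    · rw [h.1]
      have := key (-t) (by rw [abs_neg, abs_of_pos ht.1]; exact ht.2)
      linarith

lemma nearestPt_of_mem {n : ℕ} {S : Set (Euc n)} (hc : IsCompact S) {a : Euc n} (ha : a ∈ S) :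
    nearestPt S a = a := by
  have := (nearestPt_spec hc ⟨a, ha⟩ a).2
  rw [infDist_zero_of_mem ha] at this
  exact (dist_eq_zero.1 this).symm

lemma nuGeo_of_mem (hc : IsCompact (frontier U)) {a : Euc n} (ha : a ∈ frontier U) :
    B.nuGeo a = B.nu a := by
  rw [nuGeo, nearestPt_of_mem hc ha]

lemma norm_nuGeo (hc : IsCompact (frontier U)) (hne : (frontier U).Nonempty) (z : Euc n) :
    ‖B.nuGeo z‖ = 1 :=
  B.norm_nu (B.grad_ne _ (nearestPt_spec hc hne z).1)

lemma contDiffAt_nuGeo (hU : IsOpen U) (hc : IsCompact (frontier U)) {a : Euc n}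
    (ha : a ∈ frontier U) : ContDiffAt ℝ 2 B.nuGeo a := by
  have h1 := (B.exists_normal_coordinates hU hc ha).1
  refine ContDiffAt.comp a (f := nearestPt (frontier U)) (g := B.nu) ?_ h1
  rw [nearestPt_of_mem hc ha]
  exact B.contDiffAt_nu (B.front ha) (B.grad_ne a ha)

/-- The signed distance to the boundary, whose gradient is the extended normal. -/
lemma exists_signedDist (hU : IsOpen U) (hc : IsCompact (frontier U)) {a : Euc n}
    (ha : a ∈ frontier U) :
    ∃ s : Euc n → ℝ, ContDiffAt ℝ 2 s a ∧ s a = 0 ∧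
      (∀ᶠ z in 𝓝 a, ∀ v, fderiv ℝ s z v = inner ℝ (B.nuGeo z) v) ∧
      ∀ᶠ z in 𝓝 a, nearestPt (frontier U) z = z - s z • B.nuGeo z := by
  have hne : (frontier U).Nonempty := ⟨a, ha⟩
  obtain ⟨hπ, ⟨s, hs, hsa, hz⟩, -⟩ := B.exists_normal_coordinates hU hc ha
  have hN := B.contDiffAt_nuGeo hU hc ha
  refine ⟨s, hs, hsa, ?_, hz.mono fun z h => eq_sub_of_add_eq h.symm⟩
  filter_upwards [hz.eventually_nhds, hπ.eventually (by simp), hs.eventually (by simp),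
    hN.eventually (by simp)] with z h1 h2 h3 h4 v
  have h2' := (h2.differentiableAt two_ne_zero).hasFDerivAt
  have h3' := (h3.differentiableAt two_ne_zero).hasFDerivAt
  have h4' := (h4.differentiableAt two_ne_zero).hasFDerivAt
  set q := nearestPt (frontier U) z with hq
  have hqS : q ∈ frontier U := (nearestPt_spec hc hne z).1
  have hfd : HasFDerivAt B.f (fderiv ℝ B.f q) q :=
    ((B.contDiffAt_f (B.front hqS)).differentiableAt three_ne_zero).hasFDerivAt
  have htan : inner ℝ (B.nuGeo z) (fderiv ℝ (nearestPt (frontier U)) z v) = 0 := by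
    have hcomp : HasFDerivAt (fun w => B.f (nearestPt (frontier U) w)) _ z := hfd.comp z h2'
    have hconst : (fun w => B.f (nearestPt (frontier U) w)) = fun _ => (0 : ℝ) :=
      funext fun w => B.zero _ (nearestPt_spec hc hne w).1
    rw [hconst] at hcomp
    have := congrArg (fun T => T v) (hcomp.unique (hasFDerivAt_const (0 : ℝ) z))
    simp only [ContinuousLinearMap.comp_apply, zero_apply, ← inner_gradient_left] at this
    rw [nuGeo, nu, real_inner_smul_left, ← hq, this, mul_zero]
  have hid : HasFDerivAt (fun w => nearestPt (frontier U) w + s w • B.nuGeo w) _ z :=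
    h2'.add (h3'.smul h4')
  have hv := congrArg (fun T => T v)
    ((hid.congr_of_eventuallyEq h1).unique (hasFDerivAt_id z))
  have hunit := B.norm_nuGeo hc hne
  have := congrArg (fun w => inner ℝ (B.nuGeo z) w) hv
  simp only [add_apply, smul_apply, ContinuousLinearMap.smulRight_apply,
    ContinuousLinearMap.id_apply, inner_add_right, real_inner_smul_right, htan,
    inner_fderiv_eq_zero_of_norm_eq_one (h4.differentiableAt two_ne_zero)
      (Eventually.of_forall hunit), real_inner_self_eq_norm_sq, hunit z] at this
  linarith

lemma uniqRadius_mul_abs_inner_nu_sub_le (hU : IsOpen U) (hc : IsCompact (frontier U))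
    {a y : Euc n} (ha : a ∈ frontier U) (hy : y ∈ frontier U) :
    uniqRadius (frontier U) * |inner ℝ (B.nu y - B.nu a) (y - a)| ≤ ‖y - a‖ ^ 2 := by
  have h1 := B.two_mul_abs_inner_nu_le hU hc ha hy
  have h2 := B.two_mul_abs_inner_nu_le hU hc hy ha
  rw [← neg_sub, inner_neg_right, abs_neg, norm_neg] at h2
  rcases le_or_gt (uniqRadius (frontier U)) 0 with hL | hL
  · nlinarith [sq_nonneg ‖y - a‖,
      mul_nonneg (neg_nonneg.2 hL) (abs_nonneg (inner ℝ (B.nu y - B.nu a) (y - a)))]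
  have h3 := mul_le_mul_of_nonneg_left
    (abs_sub (inner ℝ (B.nu y) (y - a)) (inner ℝ (B.nu a) (y - a))) hL.le
  rw [inner_sub_left]
  linarith

/-- The curvature of the boundary is at most the inverse of the uniqueness radius. -/
lemma uniqRadius_mul_abs_inner_fderiv_nuGeo_le (hU : IsOpen U) (hc : IsCompact (frontier U))
    {a : Euc n} (ha : a ∈ frontier U) (u : Euc n) :
    uniqRadius (frontier U) * |inner ℝ (fderiv ℝ B.nuGeo a u) u| ≤ ‖u‖ ^ 2 := by
  have hne : (frontier U).Nonempty := ⟨a, ha⟩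
  obtain ⟨s, hs, hsa, hds, hπ⟩ := B.exists_signedDist hU hc ha
  have hN := B.contDiffAt_nuGeo hU hc ha
  have hunit := B.norm_nuGeo hc hne
  have hπa := nearestPt_of_mem hc ha
  have hN' : HasFDerivAt B.nuGeo (fderiv ℝ B.nuGeo a) a :=
    (hN.differentiableAt two_ne_zero).hasFDerivAt
  have hπ' : HasFDerivAt (nearestPt (frontier U)) (fderiv ℝ (nearestPt (frontier U)) a) a :=
    ((B.exists_normal_coordinates hU hc ha).1.differentiableAt two_ne_zero).hasFDerivAt
  have hlim1 := (hN'.hasLineDerivAt u).tendsto_slope_zero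
  have hlim2 := (hπ'.hasLineDerivAt u).tendsto_slope_zero
  have hPu : fderiv ℝ (nearestPt (frontier U)) a u = u - inner ℝ (B.nuGeo a) u • B.nuGeo a := by
    rw [(eventually_fderiv_proj hs hN hds hπ).self_of_nhds]
    simp [hsa]
  have hlim := le_of_tendsto_of_tendsto
    (((hlim1.inner hlim2).abs).const_mul (uniqRadius (frontier U))) (hlim2.norm.pow 2)
    (Eventually.of_forall fun t => ?_)
  · have horth : inner ℝ (fderiv ℝ B.nuGeo a u) (B.nuGeo a) = 0 := by
      rw [real_inner_comm]
      exact inner_fderiv_eq_zero_of_norm_eq_one hN'.differentiableAt (Eventually.of_forall hunit) u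
    rw [hPu, inner_sub_right, real_inner_smul_right, horth, mul_zero, sub_zero] at hlim
    nlinarith [norm_sq_sub_inner_smul (hunit a) u, sq_nonneg (inner ℝ (B.nuGeo a) u)]
  · have h := B.uniqRadius_mul_abs_inner_nu_sub_le hU hc ha (nearestPt_spec hc hne (a + t • u)).1
    have h' := mul_le_mul_of_nonneg_left h (sq_nonneg t⁻¹)
    simp only [hπa, real_inner_smul_left, real_inner_smul_right, norm_smul,
      abs_mul, mul_pow, Real.norm_eq_abs, sq_abs, B.nuGeo_of_mem hc ha]
    rw [show B.nuGeo (a + t • u) = B.nu (nearestPt (frontier U) (a + t • u)) from rfl]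
    refine le_trans (le_of_eq ?_) h'
    rw [← sq_abs t⁻¹]
    ring

/-- On the half corona, the second differential of the projection is controlled by that of the
normal at the foot point. -/
lemma norm_fderiv_fderiv_nearestPt_le (hU : IsOpen U) (hc : IsCompact (frontier U)) {a : Euc n}
    (ha : a ∈ frontier U) (hL : 0 < uniqRadius (frontier U)) {t : ℝ}
    (ht : |t| < uniqRadius (frontier U) / 2) :
    ContDiffAt ℝ 2 (nearestPt (frontier U)) (a + t • B.nu a) ∧
    ‖fderiv ℝ (fderiv ℝ (nearestPt (frontier U))) (a + t • B.nu a)‖ ≤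
      8 * max (uniqRadius (frontier U))⁻¹
        (uniqRadius (frontier U) * ‖fderiv ℝ (fderiv ℝ B.nuGeo) a‖) := by
  have hne : (frontier U).Nonempty := ⟨a, ha⟩
  obtain ⟨s, hs, hsa, hds, hπ⟩ := B.exists_signedDist hU hc ha
  have hπc := (B.exists_normal_coordinates hU hc ha).1
  have hN := B.contDiffAt_nuGeo hU hc ha
  have hunit := B.norm_nuGeo hc hne
  have hN' : HasFDerivAt B.nuGeo (fderiv ℝ B.nuGeo a) a :=
    (hN.differentiableAt two_ne_zero).hasFDerivAt
  have hN2 : HasFDerivAt (fderiv ℝ B.nuGeo) (fderiv ℝ (fderiv ℝ B.nuGeo) a) a :=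
    ((hN.fderiv_right (m := 1) (by norm_num)).differentiableAt one_ne_zero).hasFDerivAt
  have hsymm := inner_fderiv_normal_symm hs hN hds
  have hHle := norm_le_of_abs_inner_self_le hL hsymm
    (B.uniqRadius_mul_abs_inner_fderiv_nuGeo_le hU hc ha)
  have hHN : fderiv ℝ B.nuGeo a (B.nuGeo a) = 0 := by
    refine ext_inner_right ℝ fun v => ?_
    rw [hsymm, inner_fderiv_eq_zero_of_norm_eq_one hN'.differentiableAt
      (Eventually.of_forall hunit), inner_zero_left]
  set G : Euc n → Euc n := fun y => y + t • B.nuGeo y with hGdef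
  have hG : ContDiffAt ℝ 2 G a := contDiffAt_id.add (hN.const_smul t)
  have hGa : G a = a + t • B.nu a := by rw [hGdef]; simp only [B.nuGeo_of_mem hc ha]
  have hG' : ∀ᶠ y in 𝓝 a, fderiv ℝ G y =
      ContinuousLinearMap.id ℝ (Euc n) + t • fderiv ℝ B.nuGeo y := by
    filter_upwards [hN.eventually (by simp)] with y hy
    exact ((hasFDerivAt_id y).add
      ((hy.differentiableAt two_ne_zero).hasFDerivAt.const_smul t)).fderiv
  have hG'a : ∀ u, fderiv ℝ G a u = u + t • fderiv ℝ B.nuGeo a u := fun u => by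
    rw [hG'.self_of_nhds]; rfl
  have hG'' : ∀ u v, fderiv ℝ (fderiv ℝ G) a u v = t • fderiv ℝ (fderiv ℝ B.nuGeo) a u v := by
    intro u v
    rw [(((hN2.const_smul t).const_add _).congr_of_eventuallyEq hG').fderiv]
    rfl
  have hπG : ∀ᶠ y in 𝓝 a, nearestPt (frontier U) (G y) = nearestPt (frontier U) y := by
    have hsmall : ∀ᶠ y in 𝓝 a, |s y + t| < uniqRadius (frontier U) := by
      have : ContinuousAt (fun y => |s y + t|) a := by
        have := hs.continuousAt
        fun_prop
      refine this.eventually (gt_mem_nhds ?_)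
      change |s a + t| < uniqRadius (frontier U)
      rw [hsa, zero_add]
      linarith
    filter_upwards [hπ, hsmall] with y hy hsy
    have : G y = nearestPt (frontier U) y + (s y + t) • B.nu (nearestPt (frontier U) y) := by
      change y + t • B.nuGeo y = nearestPt (frontier U) y + (s y + t) • B.nuGeo y
      rw [hy, add_smul]; abel
    rw [this, B.nearestPt_add_smul_nu hU hc (nearestPt_spec hc hne y).1 hsy]
  have hinj : ∀ u, fderiv ℝ G a u = 0 → u = 0 := by
    intro u hu
    rw [hG'a] at hu
    have h1 : ‖u‖ = |t| * ‖fderiv ℝ B.nuGeo a u‖ := by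
      rw [eq_neg_of_add_eq_zero_left hu, norm_neg, norm_smul, Real.norm_eq_abs,
        ← eq_neg_of_add_eq_zero_left hu]
    have h2 := mul_le_mul_of_nonneg_right ht.le (norm_nonneg (fderiv ℝ B.nuGeo a u))
    have h3 := hHle u
    exact norm_le_zero_iff.1 (by linarith)
  obtain ⟨g, hgc, hga, -, hgr⟩ := exists_contDiffAt_local_inverse hG
    (hG.differentiableAt two_ne_zero).hasFDerivAt hinj
  have hπx : ContDiffAt ℝ 2 (nearestPt (frontier U)) (G a) := by
    have hcomp : ContDiffAt ℝ 2 (fun z => nearestPt (frontier U) (g z)) (G a) :=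
      ContDiffAt.comp (G a) (f := g) (g := nearestPt (frontier U)) (by rwa [hga]) hgc
    refine hcomp.congr_of_eventuallyEq ?_
    have hgt : Tendsto g (𝓝 (G a)) (𝓝 a) := by
      have := hgc.continuousAt.tendsto
      rwa [hga] at this
    filter_upwards [hgr, hgt.eventually hπG] with z h1 h2
    rwa [h1] at h2
  rw [← hGa]
  refine ⟨hπx, ?_⟩
  refine norm_secondDifferential_le (hunit a) hL ht.le hsymm hHN hHle
    (P := fderiv ℝ (nearestPt (frontier U)) (G a)) ?_ ?_
  · intro u
    have hcomp : HasFDerivAt (fun y => nearestPt (frontier U) (G y)) _ a :=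
      (hπx.differentiableAt two_ne_zero).hasFDerivAt.comp a
        (hG.differentiableAt two_ne_zero).hasFDerivAt
    have := congrArg (fun T => T u) ((hcomp.congr_of_eventuallyEq
      (hπG.mono fun _ hy => hy.symm)).fderiv)
    rw [(eventually_fderiv_proj hs hN hds hπ).self_of_nhds] at this
    simp only [ContinuousLinearMap.comp_apply, hG'a] at this
    rw [← this]
    simp [hsa]
  · intro u v
    rw [← hG'a, ← hG'a, ← hG'', ← fderiv_fderiv_comp hG hπx hπG,
      fderiv_fderiv_proj hs hN hsa hds hπ]

end CkDomain

lemma fderiv_fderiv_reflAcross {n : ℕ} {S : Set (Euc n)} {x : Euc n}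
    (h : ContDiffAt ℝ 2 (nearestPt S) x) :
    fderiv ℝ (fderiv ℝ (reflAcross S)) x = (2 : ℝ) • fderiv ℝ (fderiv ℝ (nearestPt S)) x := by
  have h1 : ∀ᶠ z in 𝓝 x, fderiv ℝ (reflAcross S) z =
      (2 : ℝ) • fderiv ℝ (nearestPt S) z - ContinuousLinearMap.id ℝ (Euc n) := by
    filter_upwards [h.eventually (by simp)] with z hz
    exact (((hz.differentiableAt two_ne_zero).hasFDerivAt.const_smul (2 : ℝ)).sub
      (hasFDerivAt_id z)).fderiv
  have h2 : HasFDerivAt (fderiv ℝ (nearestPt S)) (fderiv ℝ (fderiv ℝ (nearestPt S)) x) x :=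
    ((h.fderiv_right (m := 1) (by norm_num)).differentiableAt one_ne_zero).hasFDerivAt
  exact (((h2.const_smul (2 : ℝ)).sub_const _).congr_of_eventuallyEq h1).fderiv

/-- Corollary B.4: on the sub-corona `ω_{1/2}`, with `a = π(x)`,
`|D²σ_x|_bil ≤ 16 max (1/L) (L |D²ν_a|_bil)`. -/
theorem stmt18 (n : ℕ) (U : Set (Euc n)) (hU : IsOpen U)
    (hfne : (frontier U).Nonempty) (hfc : IsCompact (frontier U))
    (B : CkDomain n 3 U) (hL : 0 < uniqRadius (frontier U)) :
    ∀ x ∈ U, 0 < infDist x (frontier U) →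
      infDist x (frontier U) < uniqRadius (frontier U) / 2 →
      ‖fderiv ℝ (fderiv ℝ (reflAcross (frontier U))) x‖ ≤
        16 * max (uniqRadius (frontier U))⁻¹
          (uniqRadius (frontier U) *
            ‖fderiv ℝ (fderiv ℝ B.nuGeo) (nearestPt (frontier U) x)‖) := by
  intro x _ _ hx
  obtain ⟨hq, hqd⟩ := nearestPt_spec hfc hfne x
  set a := nearestPt (frontier U) x with ha
  have hxa := B.sub_eq_inner_smul_nu hU hq hqd
  set t := inner ℝ (x - a) (B.nu a)
  have ht : |t| = infDist x (frontier U) := by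
    rw [← hqd, dist_eq_norm, hxa, norm_smul, B.norm_nu (B.grad_ne a hq), mul_one, Real.norm_eq_abs]
  obtain ⟨h1, h2⟩ := B.norm_fderiv_fderiv_nearestPt_le hU hfc hq hL (ht.trans_lt hx)
  rw [← hxa, add_sub_cancel] at h1 h2
  rw [fderiv_fderiv_reflAcross h1, two_smul]
  have h3 := norm_add_le (fderiv ℝ (fderiv ℝ (nearestPt (frontier U))) x)
    (fderiv ℝ (fderiv ℝ (nearestPt (frontier U))) x)
  linarith

end
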